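/- For every integer n ≥ 4, the word (b a^{n−1})^{n−3} b a, of length n(n−3) + 2 = n² − 3n + 2, is a reset word for the automaton 𝒟''_n. -/

import Mathlib

/-- The two input letters of the automaton. -/
inductive Letter | a | b

/-- Transition function of the automaton `𝒟''ₙ` on states `{1, …, n}`:
`δ(i,a) = δ(i,b) = i+1` for `1 ≤ i ≤ n-2`, `δ(n-1,a) = 1`, `δ(n-1,b) = n`,
`δ(n,a) = 1`, `δ(n,b) = 2`. -/
def delta (n : ℕ) (q : ℕ) : Letter → ℕ
  | Letter.a => if q < n - 1 then q + 1 else if q = n - 1 then 1 else 1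
  | Letter.b => if q < n - 1 then q + 1 else if q = n - 1 then n else 2

/-- `w` is a reset word: it sends every state in `{1, …, n}` to one single state. -/
def IsReset (n : ℕ) (w : List Letter) : Prop :=
  ∃ p : ℕ, ∀ q ∈ Finset.Icc 1 n, w.foldl (delta n) q = p

/-- The word `(b a^{n-1})^{n-3} b a`. -/
def theWord (n : ℕ) : List Letter :=
  (List.replicate (n - 3) (Letter.b :: List.replicate (n - 1) Letter.a)).flatten
    ++ [Letter.b, Letter.a]

theorem foldl_replicate_a_of_add_le {n q k : ℕ} (h : q + k ≤ n - 1) :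
    (List.replicate k Letter.a).foldl (delta n) q = q + k := by
  induction k generalizing q with
  | zero => rfl
  | succ k ih =>
    have hq : delta n q Letter.a = q + 1 := by simp only [delta]; rw [if_pos (by omega)]
    rw [List.replicate_succ, List.foldl_cons, hq, ih (by omega)]
    omega

/-- From a state outside the linear part, `a^{k+1}` first resets to `1`, then counts up. -/
theorem foldl_replicate_a_succ_of_le {n q k : ℕ} (hq : n - 1 ≤ q) (hk : k + 1 ≤ n - 1) :
    (List.replicate (k + 1) Letter.a).foldl (delta n) q = k + 1 := by
  have h : delta n q Letter.a = 1 := by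
    simp only [delta]; rw [if_neg (by omega)]; split_ifs <;> rfl
  rw [List.replicate_succ, List.foldl_cons, h, foldl_replicate_a_of_add_le (by omega)]
  omega

/-- The states `1, …, n-1` form an `a`-cycle of length `n-1`. -/
theorem foldl_replicate_a_cycle {n q : ℕ} (h1 : 1 ≤ q) (hq : q ≤ n - 1) :
    (List.replicate (n - 1) Letter.a).foldl (delta n) q = q := by
  have hsplit : n - 1 = (n - 1 - q) + ((q - 1) + 1) := by omega
  have hrep : List.replicate (n - 1) Letter.a =
      List.replicate (n - 1 - q) Letter.a ++ List.replicate ((q - 1) + 1) Letter.a := by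
    rw [← List.replicate_add, ← hsplit]
  rw [hrep, List.foldl_append, foldl_replicate_a_of_add_le (k := n - 1 - q) (by omega),
    foldl_replicate_a_succ_of_le (by omega) (by omega)]
  omega

/-- The block `b a^{n-1}` moves each of the states `1, …, n-1` one step towards `n-1`. -/
theorem foldl_block {n q : ℕ} (h1 : 1 ≤ q) (hq : q ≤ n - 1) (hn : 2 ≤ n) :
    (Letter.b :: List.replicate (n - 1) Letter.a).foldl (delta n) q = min (q + 1) (n - 1) := by
  rw [List.foldl_cons]
  rcases hq.lt_or_eq with h | h
  · have hb : delta n q Letter.b = q + 1 := by simp only [delta]; rw [if_pos h]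
    rw [hb, foldl_replicate_a_cycle (by omega) (by omega)]
    omega
  · have hb : delta n q Letter.b = n := by
      simp only [delta]; rw [if_neg (by omega), if_pos h]
    obtain ⟨k, hk⟩ : ∃ k, n - 1 = k + 1 := ⟨n - 2, by omega⟩
    rw [hb, hk, foldl_replicate_a_succ_of_le (by omega) (by omega)]
    omega

theorem foldl_block_last {n : ℕ} (hn : 3 ≤ n) :
    (Letter.b :: List.replicate (n - 1) Letter.a).foldl (delta n) n = 2 := by
  have hb : delta n n Letter.b = 2 := by
    simp only [delta]; rw [if_neg (by omega), if_neg (by omega)]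
  rw [List.foldl_cons, hb, foldl_replicate_a_cycle (by omega) (by omega)]

theorem foldl_blocks {n q : ℕ} (k : ℕ) (h1 : 1 ≤ q) (hq : q ≤ n - 1) (hn : 2 ≤ n) :
    (List.replicate k (Letter.b :: List.replicate (n - 1) Letter.a)).flatten.foldl (delta n) q =
      min (q + k) (n - 1) := by
  induction k generalizing q with
  | zero => simpa using hq
  | succ k ih =>
    rw [List.replicate_succ, List.flatten_cons, List.foldl_append, foldl_block h1 hq hn,
      ih (by omega) (by omega)]
    omega

theorem foldl_ba {n q : ℕ} (h : q = n - 2 ∨ q = n - 1) (hn : 2 ≤ n) :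
    [Letter.b, Letter.a].foldl (delta n) q = 1 := by
  simp only [List.foldl_cons, List.foldl_nil, delta]
  split_ifs <;> omega

/-- The word `(b a^{n-1})^{n-3} b a`, of length `n(n-3) + 2 = n² - 3n + 2`,
is a reset word for `𝒟''ₙ`. -/
theorem dsecond_automaton_reset_word (n : ℕ) (hn : 4 ≤ n) :
    (theWord n).length = n ^ 2 - 3 * n + 2 ∧ IsReset n (theWord n) := by
  refine ⟨?_, 1, fun q hq => ?_⟩
  · obtain ⟨m, rfl⟩ := Nat.exists_eq_add_of_le hn
    have hsq : (4 + m) ^ 2 = (m + 1) * (4 + m) + 3 * (4 + m) := by ring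
    have h3 : 4 + m - 3 = m + 1 := by omega
    simp [theWord, h3, hsq]
    omega
  · rw [Finset.mem_Icc] at hq
    rw [theWord, List.foldl_append]
    apply foldl_ba _ (by omega)
    rcases hq.2.lt_or_eq with h | rfl
    · rw [foldl_blocks _ hq.1 (by omega) (by omega)]
      omega
    · obtain ⟨k, hk⟩ : ∃ k, q - 3 = k + 1 := ⟨q - 4, by omega⟩
      rw [hk, List.replicate_succ, List.flatten_cons, List.foldl_append,
        foldl_block_last (by omega), foldl_blocks _ (by omega) (by omega) (by omega)]
      omega
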